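/- Let G be the subgroup of SL(2, ℤ[i]) generated by the four matrices [[1,1],[0,1]], [[1,i],[0,1]], [[0,-1],[1,0]], and [[i,0],[0,-i]]. Then for every point z = x + y·j of the upper half-space (x ∈ ℂ, y > 0) there exists γ ∈ G such that γ·z lies in the closure of the fundamental domain, i.e., γ·z = x₀' + x₁'·i + y'·j with -1/2 ≤ x₀' ≤ 1/2, 0 ≤ x₁' ≤ 1/2, and x₀'² + x₁'² + y'² ≥ 1. -/

import Mathlib

open GaussianInt Quaternion

/-- Embedding of a complex number `x = x₀ + x₁·i` into the real quaternions. -/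
noncomputable def toQ (x : ℂ) : Quaternion ℝ := ⟨x.re, x.im, 0, 0⟩

/-- The quaternion `x + y·j` with `x` complex and `y` real. -/
noncomputable def mkH (x : ℂ) (y : ℝ) : Quaternion ℝ := ⟨x.re, x.im, y, 0⟩

/-- The linear fractional transformation `z ↦ (az+b)(cz+d)⁻¹` of a quaternion,
for `γ = [[a,b],[c,d]] ∈ SL(2,ℂ)`, computed in the quaternions. -/
noncomputable def lft (γ : Matrix.SpecialLinearGroup (Fin 2) ℂ) (z : Quaternion ℝ) :
    Quaternion ℝ :=
  (toQ (γ.1 0 0) * z + toQ (γ.1 0 1)) * (toQ (γ.1 1 0) * z + toQ (γ.1 1 1))⁻¹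

/-- The translation matrix `[[1,1],[0,1]]` in `SL(2,ℤ[i])`. -/
def matT : Matrix.SpecialLinearGroup (Fin 2) GaussianInt :=
  ⟨!![1, 1; 0, 1], by simp [Matrix.det_fin_two_of]⟩

/-- The translation matrix `[[1,i],[0,1]]` in `SL(2,ℤ[i])`. -/
def matTi : Matrix.SpecialLinearGroup (Fin 2) GaussianInt :=
  ⟨!![1, ⟨0, 1⟩; 0, 1], by simp [Matrix.det_fin_two_of]⟩

/-- The inversion matrix `[[0,-1],[1,0]]` in `SL(2,ℤ[i])`. -/
def matS : Matrix.SpecialLinearGroup (Fin 2) GaussianInt :=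
  ⟨!![0, -1; 1, 0], by norm_num [Matrix.det_fin_two_of]⟩

/-- The matrix `[[i,0],[0,-i]]` in `SL(2,ℤ[i])`. -/
def matE : Matrix.SpecialLinearGroup (Fin 2) GaussianInt :=
  ⟨!![⟨0, 1⟩, 0; 0, -⟨0, 1⟩], by simp [Matrix.det_fin_two_of]; decide⟩

/-- The subgroup of `SL(2,ℤ[i])` generated by the four matrices `[[1,1],[0,1]]`,
`[[1,i],[0,1]]`, `[[0,-1],[1,0]]` and `[[i,0],[0,-i]]`. -/
def picardGen : Subgroup (Matrix.SpecialLinearGroup (Fin 2) GaussianInt) :=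
  Subgroup.closure {matT, matTi, matS, matE}

open scoped MatrixGroups

@[simp]
theorem toQ_re (x : ℂ) : (toQ x).re = x.re := rfl

@[simp]
theorem toQ_imI (x : ℂ) : (toQ x).imI = x.im := rfl

@[simp]
theorem toQ_imJ (x : ℂ) : (toQ x).imJ = 0 := rfl

@[simp]
theorem toQ_imK (x : ℂ) : (toQ x).imK = 0 := rfl

@[simp]
theorem mkH_re (x : ℂ) (y : ℝ) : (mkH x y).re = x.re := rfl

@[simp]
theorem mkH_imI (x : ℂ) (y : ℝ) : (mkH x y).imI = x.im := rfl

@[simp]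
theorem mkH_imJ (x : ℂ) (y : ℝ) : (mkH x y).imJ = y := rfl

@[simp]
theorem mkH_imK (x : ℂ) (y : ℝ) : (mkH x y).imK = 0 := rfl

theorem toQ_add (a b : ℂ) : toQ (a + b) = toQ a + toQ b := by
  ext <;> simp

theorem toQ_mul (a b : ℂ) : toQ (a * b) = toQ a * toQ b := by
  ext <;> simp

/-- The denominator `cz + d` of the linear fractional transformation attached to `γ`. -/
noncomputable def lftDenom (γ : SL(2, ℂ)) (z : Quaternion ℝ) : Quaternion ℝ :=
  toQ (γ.1 1 0) * z + toQ (γ.1 1 1)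

theorem normSq_lftDenom_mkH (γ : SL(2, ℂ)) (x : ℂ) (y : ℝ) :
    normSq (lftDenom γ (mkH x y)) =
      Complex.normSq (γ.1 1 0 * x + γ.1 1 1) + Complex.normSq (γ.1 1 0) * y ^ 2 := by
  simp [lftDenom, Quaternion.normSq_def', Complex.normSq_apply]
  ring

theorem lftDenom_mkH_ne_zero (γ : SL(2, ℂ)) (x : ℂ) {y : ℝ} (hy : 0 < y) :
    lftDenom γ (mkH x y) ≠ 0 := by
  rw [← Quaternion.normSq_ne_zero, normSq_lftDenom_mkH]
  have hdet := γ.det_coe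
  rw [Matrix.det_fin_two] at hdet
  by_cases hc : γ.1 1 0 = 0
  · have hd : γ.1 1 1 ≠ 0 := by
      intro hd
      simp [hc, hd] at hdet
    simpa [hc] using hd
  · have := Complex.normSq_pos.2 hc
    have := Complex.normSq_nonneg (γ.1 1 0 * x + γ.1 1 1)
    positivity

theorem normSq_lftDenom_mkH_pos (γ : SL(2, ℂ)) (x : ℂ) {y : ℝ} (hy : 0 < y) :
    0 < normSq (lftDenom γ (mkH x y)) :=
  lt_of_le_of_ne Quaternion.normSq_nonneg
    (Quaternion.normSq_ne_zero.2 (lftDenom_mkH_ne_zero γ x hy)).symm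

theorem lft_mul (γ δ : SL(2, ℂ)) {z : Quaternion ℝ} (hz : lftDenom δ z ≠ 0) :
    lft (γ * δ) z = lft γ (lft δ z) := by
  have key (a b : ℂ) : toQ (a * δ.1 0 0 + b * δ.1 1 0) * z + toQ (a * δ.1 0 1 + b * δ.1 1 1) =
      (toQ a * lft δ z + toQ b) * lftDenom δ z := by
    have h : lft δ z * lftDenom δ z = toQ (δ.1 0 0) * z + toQ (δ.1 0 1) :=
      inv_mul_cancel_right₀ hz _
    rw [add_mul, mul_assoc, h, lftDenom]
    simp only [toQ_add, toQ_mul]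
    noncomm_ring
  rw [lft, lft.eq_def γ]
  simp only [Matrix.SpecialLinearGroup.coe_mul, Matrix.mul_apply, Fin.sum_univ_two, key]
  rw [mul_inv_rev, mul_assoc, mul_inv_cancel_left₀ hz]

theorem lft_mkH (γ : SL(2, ℂ)) (x : ℂ) (y : ℝ) :
    ∃ x' : ℂ, lft γ (mkH x y) = mkH x' (y / normSq (lftDenom γ (mkH x y))) := by
  have hdet := γ.det_coe
  rw [Matrix.det_fin_two] at hdet
  have hre := congrArg Complex.re hdet
  have him := congrArg Complex.im hdet
  simp only [Complex.sub_re, Complex.sub_im, Complex.mul_re, Complex.mul_im, Complex.one_re,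
    Complex.one_im] at hre him
  refine ⟨⟨(lft γ (mkH x y)).re, (lft γ (mkH x y)).imI⟩, ?_⟩
  have h : lft γ (mkH x y) = (toQ (γ.1 0 0) * mkH x y + toQ (γ.1 0 1)) *
      ((normSq (lftDenom γ (mkH x y)))⁻¹ • star (lftDenom γ (mkH x y))) := rfl
  ext
  · rfl
  · rfl
  · rw [h]
    generalize normSq (lftDenom γ (mkH x y)) = N
    simp only [lftDenom, Quaternion.re_mul, Quaternion.imI_mul, Quaternion.imJ_mul,
      Quaternion.imK_mul, Quaternion.re_add, Quaternion.imI_add, Quaternion.imJ_add,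
      Quaternion.imK_add, Quaternion.re_smul, Quaternion.imI_smul, Quaternion.imJ_smul,
      Quaternion.imK_smul, Quaternion.re_star, Quaternion.imI_star, Quaternion.imJ_star,
      Quaternion.imK_star, toQ_re, toQ_imI, toQ_imJ, toQ_imK, mkH_re, mkH_imI, mkH_imJ, mkH_imK,
      smul_eq_mul]
    linear_combination (y * N⁻¹) * hre
  · rw [h]
    generalize normSq (lftDenom γ (mkH x y)) = N
    simp only [lftDenom, Quaternion.re_mul, Quaternion.imI_mul, Quaternion.imJ_mul,
      Quaternion.imK_mul, Quaternion.re_add, Quaternion.imI_add, Quaternion.imJ_add,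
      Quaternion.imK_add, Quaternion.re_smul, Quaternion.imI_smul, Quaternion.imJ_smul,
      Quaternion.imK_smul, Quaternion.re_star, Quaternion.imI_star, Quaternion.imJ_star,
      Quaternion.imK_star, toQ_re, toQ_imI, toQ_imJ, toQ_imK, mkH_re, mkH_imI, mkH_imJ, mkH_imK,
      smul_eq_mul]
    linear_combination (y * N⁻¹) * him

theorem GaussianInt.finite_setOf_normSq_le (R : ℝ) :
    {a : GaussianInt | Complex.normSq (GaussianInt.toComplex a) ≤ R}.Finite := by
  let M : ℤ := ⌈R⌉
  refine ((Set.finite_Icc (-M) M).prod (Set.finite_Icc (-M) M)).image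
    (fun p : ℤ × ℤ => (⟨p.1, p.2⟩ : GaussianInt)) |>.subset ?_
  intro a ha
  have h : a.re ^ 2 + a.im ^ 2 ≤ M := by
    have : Complex.normSq (GaussianInt.toComplex a) ≤ M := ha.trans (Int.le_ceil R)
    simp only [Complex.normSq_apply, ← GaussianInt.intCast_re, ← GaussianInt.intCast_im] at this
    have : a.re * a.re + a.im * a.im ≤ M := mod_cast this
    linarith
  have hre := Int.le_self_sq a.re
  have hre' := Int.le_self_sq (-a.re)
  have him := Int.le_self_sq a.im
  have him' := Int.le_self_sq (-a.im)
  refine ⟨(a.re, a.im), ⟨⟨?_, ?_⟩, ⟨?_, ?_⟩⟩, rfl⟩ <;> dsimp only <;>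
    nlinarith [sq_nonneg a.re, sq_nonneg a.im]

theorem GaussianInt.finite_setOf_normSq_linear_le (x : ℂ) {y : ℝ} (hy : 0 < y) (R : ℝ) :
    {p : GaussianInt × GaussianInt |
      Complex.normSq (GaussianInt.toComplex p.1 * x + GaussianInt.toComplex p.2) +
        Complex.normSq (GaussianInt.toComplex p.1) * y ^ 2 ≤ R}.Finite := by
  refine ((GaussianInt.finite_setOf_normSq_le (R / y ^ 2)).prod
    (GaussianInt.finite_setOf_normSq_le
      (2 * R + 2 * (R / y ^ 2 * Complex.normSq x)))).subset ?_
  rintro ⟨c, d⟩ h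
  simp only [Set.mem_ofPred_eq] at h
  set c' := GaussianInt.toComplex c
  set d' := GaussianInt.toComplex d
  have h₁ := Complex.normSq_nonneg (c' * x + d')
  have h₂ : 0 ≤ Complex.normSq c' * y ^ 2 := mul_nonneg (Complex.normSq_nonneg _) (sq_nonneg y)
  have hc : Complex.normSq c' ≤ R / y ^ 2 := by
    rw [le_div_iff₀ (by positivity)]
    linarith
  refine ⟨hc, ?_⟩
  have hcx := mul_le_mul_of_nonneg_right hc (Complex.normSq_nonneg x)
  have hpar : Complex.normSq d' ≤
      2 * Complex.normSq (c' * x + d') + 2 * (Complex.normSq c' * Complex.normSq x) := by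
    rw [← Complex.normSq_mul]
    generalize c' * x = u
    simp only [Complex.normSq_apply, Complex.add_re, Complex.add_im]
    nlinarith [sq_nonneg (2 * u.re + d'.re), sq_nonneg (2 * u.im + d'.im)]
  change Complex.normSq d' ≤ _
  linarith

/-- The action of `SL(2,ℤ[i])` on quaternions by linear fractional transformations. -/
noncomputable def picardLft (γ : SL(2, GaussianInt)) (z : Quaternion ℝ) : Quaternion ℝ :=
  lft (Matrix.SpecialLinearGroup.map GaussianInt.toComplex γ) z

theorem picardLft_mul_mkH (γ δ : SL(2, GaussianInt)) (x : ℂ) {y : ℝ} (hy : 0 < y) :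
    picardLft (γ * δ) (mkH x y) = picardLft γ (picardLft δ (mkH x y)) := by
  rw [picardLft, map_mul]
  exact lft_mul _ _ (lftDenom_mkH_ne_zero _ x hy)

theorem exists_mem_imJ_picardLft_le (G : Subgroup SL(2, GaussianInt)) (x : ℂ) {y : ℝ}
    (hy : 0 < y) :
    ∃ γ ∈ G, ∀ δ ∈ G, (picardLft δ (mkH x y)).imJ ≤ (picardLft γ (mkH x y)).imJ := by
  let f : GaussianInt × GaussianInt → ℝ := fun p =>
    Complex.normSq (GaussianInt.toComplex p.1 * x + GaussianInt.toComplex p.2) +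
      Complex.normSq (GaussianInt.toComplex p.1) * y ^ 2
  let row : SL(2, GaussianInt) → GaussianInt × GaussianInt := fun γ => (γ.1 1 0, γ.1 1 1)
  have hf (γ : SL(2, GaussianInt)) : normSq (lftDenom
      (Matrix.SpecialLinearGroup.map GaussianInt.toComplex γ) (mkH x y)) = f (row γ) :=
    normSq_lftDenom_mkH _ x y
  have hheight (γ : SL(2, GaussianInt)) : (picardLft γ (mkH x y)).imJ = y / f (row γ) := by
    obtain ⟨x', hx'⟩ := lft_mkH (Matrix.SpecialLinearGroup.map GaussianInt.toComplex γ) x y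
    rw [picardLft, hx', hf]
    rfl
  have hpos (γ : SL(2, GaussianInt)) : 0 < f (row γ) :=
    hf γ ▸ normSq_lftDenom_mkH_pos _ x hy
  have hfin : (Set.image row G ∩ {p | f p ≤ f (row 1)}).Finite :=
    (GaussianInt.finite_setOf_normSq_linear_le x hy _).subset Set.inter_subset_right
  obtain ⟨_, ⟨⟨γ, hγ, rfl⟩, hγ₁⟩, hmin⟩ := Set.exists_min_image _ f hfin
    ⟨row 1, ⟨1, G.one_mem, rfl⟩, le_refl (f (row 1))⟩
  refine ⟨γ, hγ, fun δ hδ => ?_⟩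
  rw [hheight, hheight]
  refine div_le_div_of_nonneg_left hy.le (hpos γ) ?_
  rcases le_total (f (row δ)) (f (row 1)) with h | h
  · exact hmin _ ⟨⟨δ, hδ, rfl⟩, h⟩
  · exact le_trans hγ₁ h

/-- Upper unitriangular matrices, as a homomorphism from the additive group of `ℤ[i]`. -/
def unitriangularHom : Multiplicative GaussianInt →* SL(2, GaussianInt) where
  toFun b := ⟨!![1, b.toAdd; 0, 1], by simp [Matrix.det_fin_two_of]⟩
  map_one' := by
    refine Subtype.ext (Matrix.ext fun i j => ?_)
    fin_cases i <;> fin_cases j <;> simp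
  map_mul' a b := by
    refine Subtype.ext ?_
    change !![1, a.toAdd + b.toAdd; 0, 1] = !![1, a.toAdd; 0, 1] * !![1, b.toAdd; 0, 1]
    simp [add_comm]

theorem unitriangularHom_mem_picardGen (b : GaussianInt) :
    unitriangularHom (Multiplicative.ofAdd b) ∈ picardGen := by
  have hb : b = b.re • (1 : GaussianInt) + b.im • (⟨0, 1⟩ : GaussianInt) := by
    ext <;> simp
  have hT : unitriangularHom (Multiplicative.ofAdd 1) ∈ picardGen :=
    Subgroup.subset_closure (Or.inl rfl)
  have hTi : unitriangularHom (Multiplicative.ofAdd ⟨0, 1⟩) ∈ picardGen :=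
    Subgroup.subset_closure (Or.inr (Or.inl rfl))
  rw [hb, ofAdd_add, ofAdd_zsmul, ofAdd_zsmul, map_mul, map_zpow, map_zpow]
  exact mul_mem (zpow_mem hT _) (zpow_mem hTi _)

theorem matS_mem_picardGen : matS ∈ picardGen :=
  Subgroup.subset_closure (Or.inr (Or.inr (Or.inl rfl)))

theorem matE_mem_picardGen : matE ∈ picardGen :=
  Subgroup.subset_closure (Or.inr (Or.inr (Or.inr rfl)))

theorem picardLft_unitriangularHom_mkH (b : GaussianInt) (x : ℂ) (y : ℝ) :
    picardLft (unitriangularHom (Multiplicative.ofAdd b)) (mkH x y) =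
      mkH (x + GaussianInt.toComplex b) y := by
  have h₁ : toQ 1 = 1 := rfl
  have h₀ : toQ 0 = 0 := rfl
  have h : picardLft (unitriangularHom (Multiplicative.ofAdd b)) (mkH x y) =
      (toQ (GaussianInt.toComplex 1) * mkH x y + toQ (GaussianInt.toComplex b)) *
        (toQ (GaussianInt.toComplex 0) * mkH x y + toQ (GaussianInt.toComplex 1))⁻¹ := rfl
  rw [h, map_one, map_zero, h₁, h₀, one_mul, zero_mul, zero_add, inv_one, mul_one]
  ext <;> simp

theorem picardLft_matE_mkH (x : ℂ) (y : ℝ) : picardLft matE (mkH x y) = mkH (-x) y := by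
  have h₀ : toQ 0 = 0 := rfl
  have hI : GaussianInt.toComplex ⟨0, 1⟩ = Complex.I := by
    simp [GaussianInt.toComplex_def']
  have hinv : (toQ (-Complex.I))⁻¹ = toQ Complex.I := by
    refine inv_eq_of_mul_eq_one_right ?_
    ext <;> simp
  have h : picardLft matE (mkH x y) =
      (toQ (GaussianInt.toComplex ⟨0, 1⟩) * mkH x y + toQ (GaussianInt.toComplex 0)) *
        (toQ (GaussianInt.toComplex 0) * mkH x y + toQ (GaussianInt.toComplex (-⟨0, 1⟩)))⁻¹ := rfl
  rw [h, map_neg, map_zero, hI, h₀, zero_mul, zero_add, add_zero, hinv]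
  ext <;> simp

theorem imJ_picardLft_matS_mkH (x : ℂ) (y : ℝ) :
    (picardLft matS (mkH x y)).imJ = y / (x.re ^ 2 + x.im ^ 2 + y ^ 2) := by
  obtain ⟨x', hx'⟩ := lft_mkH (Matrix.SpecialLinearGroup.map GaussianInt.toComplex matS) x y
  have hc : (Matrix.SpecialLinearGroup.map GaussianInt.toComplex matS).1 1 0 = 1 :=
    map_one GaussianInt.toComplex
  have hd : (Matrix.SpecialLinearGroup.map GaussianInt.toComplex matS).1 1 1 = 0 :=
    map_zero GaussianInt.toComplex
  rw [picardLft, hx', normSq_lftDenom_mkH, hc, hd]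
  simp [Complex.normSq_apply, sq]

theorem exists_picardLft_mkH_mem_strip (x : ℂ) {y : ℝ} (hy : 0 < y) :
    ∃ γ ∈ picardGen, ∃ x' : ℂ, picardLft γ (mkH x y) = mkH x' y ∧
      -(1/2) ≤ x'.re ∧ x'.re ≤ 1/2 ∧ 0 ≤ x'.im ∧ x'.im ≤ 1/2 := by
  let b : GaussianInt := ⟨-round x.re, -round x.im⟩
  have hre := abs_le.1 (abs_sub_round x.re)
  have him := abs_le.1 (abs_sub_round x.im)
  have hxre : (x + GaussianInt.toComplex b).re = x.re - round x.re := by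
    simp [b, sub_eq_add_neg]
  have hxim : (x + GaussianInt.toComplex b).im = x.im - round x.im := by
    simp [b, sub_eq_add_neg]
  have hb := unitriangularHom_mem_picardGen b
  have hbx := picardLft_unitriangularHom_mkH b x y
  rcases le_total 0 (x.im - round x.im) with h | h
  · refine ⟨_, hb, _, hbx, ?_⟩
    rw [hxre, hxim]
    exact ⟨hre.1, hre.2, h, him.2⟩
  · refine ⟨_, mul_mem matE_mem_picardGen hb, _,
      (picardLft_mul_mkH _ _ x hy).trans ((congrArg _ hbx).trans (picardLft_matE_mkH _ y)), ?_⟩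
    rw [Complex.neg_re, Complex.neg_im, hxre, hxim]
    refine ⟨?_, ?_, ?_, ?_⟩ <;> linarith [hre.1, hre.2, him.1]

/-- Every point `z = x + y·j` of the upper half-space can be moved by an element
of the group generated by `[[1,1],[0,1]]`, `[[1,i],[0,1]]`, `[[0,-1],[1,0]]` and
`[[i,0],[0,-i]]` into the closure of the fundamental domain of the Picard group:
`γ·z = x₀' + x₁'·i + y'·j` with `-1/2 ≤ x₀' ≤ 1/2`, `0 ≤ x₁' ≤ 1/2` and
`x₀'² + x₁'² + y'² ≥ 1`. -/
theorem exists_pullback_into_closed_fundamental_domain (x : ℂ) (y : ℝ) (hy : 0 < y) :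
    ∃ γ ∈ picardGen, ∃ x₀' x₁' y' : ℝ,
      lft (Matrix.SpecialLinearGroup.map (GaussianInt.toComplex) γ) (mkH x y) =
        (⟨x₀', x₁', y', 0⟩ : Quaternion ℝ) ∧
      0 < y' ∧ -(1/2) ≤ x₀' ∧ x₀' ≤ 1/2 ∧ 0 ≤ x₁' ∧ x₁' ≤ 1/2 ∧
      1 ≤ x₀' ^ 2 + x₁' ^ 2 + y' ^ 2 := by
  obtain ⟨γ, hγ, hmax⟩ := exists_mem_imJ_picardLft_le picardGen x hy
  obtain ⟨x₁, hx₁⟩ := lft_mkH (Matrix.SpecialLinearGroup.map GaussianInt.toComplex γ) x y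
  have hy₁ := div_pos hy (normSq_lftDenom_mkH_pos
    (Matrix.SpecialLinearGroup.map GaussianInt.toComplex γ) x hy)
  set y₁ := y / normSq (lftDenom (Matrix.SpecialLinearGroup.map GaussianInt.toComplex γ)
    (mkH x y))
  change picardLft γ (mkH x y) = mkH x₁ y₁ at hx₁
  obtain ⟨δ, hδ, x₂, hx₂, hre, hre', him, him'⟩ := exists_picardLft_mkH_mem_strip x₁ hy₁
  have hδγ : picardLft (δ * γ) (mkH x y) = mkH x₂ y₁ := by
    rw [picardLft_mul_mkH _ _ x hy, hx₁, hx₂]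
  refine ⟨δ * γ, mul_mem hδ hγ, x₂.re, x₂.im, y₁, hδγ, hy₁, hre, hre', him, him', ?_⟩
  have hS := hmax (matS * (δ * γ)) (mul_mem matS_mem_picardGen (mul_mem hδ hγ))
  rw [picardLft_mul_mkH _ _ x hy, hδγ, imJ_picardLft_matS_mkH, hx₁] at hS
  change _ ≤ y₁ at hS
  rw [div_le_iff₀ (by positivity)] at hS
  exact (le_mul_iff_one_le_right hy₁).1 hS
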